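/- arXiv:1308.2902 — 2 statements merged into one kernel-verified Lean document; each statement's English description precedes it below -/
import Mathlib

section
/- Let ρ be holomorphic near 0 in ℂ² with ρ₀₀ = ρ₁₀ = ρ₀₁ = ρ₂₀ = ρ₁₁ = ρ₀₂ = ρ₃₀ = ρ₂₁ = 0 and ρ₁₂ ≠ 0. Then there exists a holomorphic coordinate chart (u,v) centered at the origin such that ρ(u,v) equals either v²u, or v²u + u^{k−1} for some k ≥ 5. -/
/-!
STATEMENT 8 (D_k normal form): If ρ is holomorphic near 0 in ℂ² with
ρ₀₀ = ρ₁₀ = ρ₀₁ = ρ₂₀ = ρ₁₁ = ρ₀₂ = ρ₃₀ = ρ₂₁ = 0 and ρ₁₂ ≠ 0, then there is a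
holomorphic coordinate chart (u,v) centered at the origin in which ρ equals either
v²u, or v²u + u^{k−1} for some k ≥ 5.
-/

/-- `pd i j f` is the partial derivative `∂^{i+j} f / ∂x^i ∂y^j` at the origin of `ℂ²`. -/
noncomputable def pd (i j : ℕ) (f : ℂ × ℂ → ℂ) : ℂ :=
  iteratedDeriv i (fun x => iteratedDeriv j (fun y => f (x, y)) 0) 0

open Filter Topology

/-- The contraction `(x, y) ↦ (x, t y)`. -/
noncomputable def shrinkY (t : ℝ) : ℂ × ℂ →L[ℂ] ℂ × ℂ :=
  (ContinuousLinearMap.fst ℂ ℂ ℂ).prod ((t : ℂ) • ContinuousLinearMap.snd ℂ ℂ ℂ)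

theorem shrinkY_apply (t : ℝ) (z : ℂ × ℂ) : shrinkY t z = (z.1, (t : ℂ) * z.2) := by
  simp [shrinkY]

theorem norm_shrinkY_apply_le {t : ℝ} (ht : t ∈ Set.Icc (0 : ℝ) 1) (z : ℂ × ℂ) :
    ‖shrinkY t z‖ ≤ ‖z‖ := by
  rw [shrinkY_apply, Prod.norm_def, Prod.norm_def]
  refine max_le_max le_rfl ?_
  rw [norm_mul, Complex.norm_real, Real.norm_eq_abs, abs_of_nonneg ht.1]
  exact mul_le_of_le_one_left (norm_nonneg _) ht.2

theorem norm_shrinkY_le {t : ℝ} (ht : t ∈ Set.Icc (0 : ℝ) 1) : ‖shrinkY t‖ ≤ 1 :=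
  ContinuousLinearMap.opNorm_le_bound _ zero_le_one
    (fun z => by simpa using norm_shrinkY_apply_le ht z)

theorem continuous_shrinkY : Continuous shrinkY := by
  have : shrinkY = fun t : ℝ => (ContinuousLinearMap.inl ℂ ℂ ℂ).comp (ContinuousLinearMap.fst ℂ ℂ ℂ)
      + (t : ℂ) • (ContinuousLinearMap.inr ℂ ℂ ℂ).comp (ContinuousLinearMap.snd ℂ ℂ ℂ) := by
    funext t
    ext <;> simp [shrinkY]
  rw [this]
  fun_prop

theorem analyticAt_integral_shrinkY {h : ℂ × ℂ → ℂ} (hh : AnalyticAt ℂ h 0) :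
    AnalyticAt ℂ (fun z => ∫ t in (0 : ℝ)..1, h (shrinkY t z)) 0 := by
  obtain ⟨p, r, hp⟩ := hh
  have hu : ∀ t ∈ Set.uIoc (0 : ℝ) 1, t ∈ Set.Icc (0 : ℝ) 1 := by
    intro t ht
    rw [Set.uIoc_of_le zero_le_one] at ht
    exact ⟨ht.1.le, ht.2⟩
  let c : ∀ n : ℕ, ℝ → ContinuousMultilinearMap ℂ (fun _ : Fin n => ℂ × ℂ) ℂ :=
    fun n t => (p n).compContinuousLinearMap (fun _ => shrinkY t)
  have hc : ∀ n, Continuous (c n) := by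
    intro n
    have h1 := (ContinuousMultilinearMap.compContinuousLinearMapContinuousMultilinear ℂ
      (fun _ : Fin n => ℂ × ℂ) (fun _ : Fin n => ℂ × ℂ) ℂ).cont
    have h2 : Continuous (fun t : ℝ => (fun _ : Fin n => shrinkY t)) :=
      continuous_pi fun _ => continuous_shrinkY
    have h3 := (h1.comp h2).clm_apply (continuous_const (y := p n))
    exact h3
  let q : FormalMultilinearSeries ℂ (ℂ × ℂ) ℂ := fun n => ∫ t in (0 : ℝ)..1, c n t
  have hcn : ∀ n, ∀ t ∈ Set.uIoc (0 : ℝ) 1, ‖c n t‖ ≤ ‖p n‖ := by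
    intro n t ht
    refine (ContinuousMultilinearMap.norm_compContinuousLinearMap_le _ _).trans ?_
    refine mul_le_of_le_one_right (norm_nonneg _) ?_
    exact Finset.prod_le_one (fun _ _ => norm_nonneg _) (fun _ _ => norm_shrinkY_le (hu t ht))
  have hqn : ∀ n, ‖q n‖ ≤ ‖p n‖ := by
    intro n
    have := intervalIntegral.norm_integral_le_of_norm_le_const (hcn n)
    simpa using this
  have hrad := FormalMultilinearSeries.radius_le_of_le hqn
  refine ⟨q, r, hp.r_le.trans hrad, hp.r_pos, ?_⟩
  intro z hz
  have hz' : z ∈ Metric.eball (0 : ℂ × ℂ) p.radius := Metric.eball_subset_eball hp.r_le hz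
  have hq : ∀ n, q n (fun _ => z) = ∫ t in (0 : ℝ)..1, p n (fun _ => shrinkY t z) := by
    intro n
    have := (ContinuousMultilinearMap.apply ℂ (fun _ : Fin n => ℂ × ℂ) ℂ
      (fun _ => z)).intervalIntegral_comp_comm ((hc n).intervalIntegrable (μ := MeasureTheory.volume) 0 1)
    exact this.symm
  have hsum : Summable (fun n => ‖p n‖ * ‖z‖ ^ n) := by
    have : ((‖z‖₊ : NNReal) : ENNReal) < p.radius := by
      simpa [enorm_eq_nnnorm] using hz'
    simpa using p.summable_norm_mul_pow this
  have key : HasSum (fun n => ∫ t in (0 : ℝ)..1, p n (fun _ => shrinkY t z))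
      (∫ t in (0 : ℝ)..1, h (shrinkY t z)) := by
    refine intervalIntegral.hasSum_integral_of_dominated_convergence
      (fun n _ => ‖p n‖ * ‖z‖ ^ n) ?_ ?_ ?_ ?_ ?_
    · intro n
      refine Continuous.aestronglyMeasurable ?_
      have := (ContinuousMultilinearMap.apply ℂ (fun _ : Fin n => ℂ × ℂ) ℂ
        (fun _ => z)).continuous.comp (hc n)
      exact this
    · intro n
      refine Eventually.of_forall fun t ht => ?_
      refine ((p n).le_opNorm _).trans ?_
      refine mul_le_mul_of_nonneg_left ?_ (norm_nonneg _)
      simpa using pow_le_pow_left₀ (norm_nonneg _) (norm_shrinkY_apply_le (hu t ht) z) n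
    · exact Eventually.of_forall fun t ht => hsum
    · exact intervalIntegrable_const
    · refine Eventually.of_forall fun t ht => ?_
      have hm : shrinkY t z ∈ Metric.eball (0 : ℂ × ℂ) r := by
        rw [Metric.mem_eball, edist_zero_right] at hz ⊢
        refine lt_of_le_of_lt ?_ hz
        rw [enorm_le_iff_norm_le]
        exact norm_shrinkY_apply_le (hu t ht) z
      simpa using hp.hasSum hm
  simp only [hq, zero_add]
  exact key

/-- Hadamard's lemma in the second variable. -/
theorem hadamardY {f : ℂ × ℂ → ℂ} (hf : AnalyticAt ℂ f 0) :
    ∃ g : ℂ × ℂ → ℂ, AnalyticAt ℂ g 0 ∧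
      ∀ᶠ z in 𝓝 (0 : ℂ × ℂ), f z = f (z.1, 0) + z.2 * g z := by
  have hh : AnalyticAt ℂ (fun z => fderiv ℂ f z (0, 1)) 0 :=
    ((ContinuousLinearMap.apply ℂ ℂ ((0, 1) : ℂ × ℂ)).analyticAt _).comp hf.fderiv
  refine ⟨_, analyticAt_integral_shrinkY hh, ?_⟩
  have hev := hf.eventually_analyticAt
  obtain ⟨ε, hε, hb⟩ := Metric.eventually_nhds_iff_ball.1 (hev.and hh.eventually_analyticAt)
  filter_upwards [Metric.ball_mem_nhds (0 : ℂ × ℂ) hε] with z hz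
  have hmem : ∀ t ∈ Set.uIcc (0 : ℝ) 1, shrinkY t z ∈ Metric.ball (0 : ℂ × ℂ) ε := by
    intro t ht
    rw [Set.uIcc_of_le zero_le_one] at ht
    rw [mem_ball_zero_iff] at hz ⊢
    exact (norm_shrinkY_apply_le ht z).trans_lt hz
  have hcont : Continuous (fun t : ℝ => shrinkY t z) :=
    continuous_shrinkY.clm_apply continuous_const
  have hder : ∀ t ∈ Set.uIcc (0 : ℝ) 1, HasDerivAt (fun t : ℝ => f (shrinkY t z))
      (z.2 * fderiv ℂ f (shrinkY t z) (0, 1)) t := by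
    intro t ht
    have h1 : HasDerivAt (fun t : ℝ => shrinkY t z) ((0, z.2) : ℂ × ℂ) t := by
      simp only [shrinkY_apply]
      refine HasDerivAt.prodMk (hasDerivAt_const _ _) ?_
      simpa using (Complex.ofRealCLM.hasDerivAt (x := t)).mul_const z.2
    have h2 := ((hb _ (hmem t ht)).1.differentiableAt.hasFDerivAt).restrictScalars ℝ
    have h3 := h2.comp_hasDerivAt t h1
    convert! h3 using 1
    have : ((0, z.2) : ℂ × ℂ) = z.2 • ((0, 1) : ℂ × ℂ) := by simp
    simp only [ContinuousLinearMap.coe_restrictScalars']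
    rw [this, map_smul, smul_eq_mul]
  have hint : IntervalIntegrable (fun t : ℝ => z.2 * fderiv ℂ f (shrinkY t z) (0, 1))
      MeasureTheory.volume 0 1 := by
    refine ContinuousOn.intervalIntegrable ?_
    refine continuousOn_const.mul ?_
    intro t ht
    exact ContinuousAt.continuousWithinAt
      (ContinuousAt.comp (f := fun t : ℝ => shrinkY t z) (hb _ (hmem t ht)).2.continuousAt
        hcont.continuousAt)
  have := intervalIntegral.integral_eq_sub_of_hasDerivAt hder hint
  rw [intervalIntegral.integral_const_mul] at this
  rw [this]
  simp [shrinkY_apply]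

theorem inverse_thm {Φ : ℂ × ℂ → ℂ × ℂ} {p : ℂ × ℂ} (hΦ : AnalyticAt ℂ Φ p)
    (hinj : ∀ v, fderiv ℂ Φ p v = 0 → v = 0) :
    ∃ Ψ : ℂ × ℂ → ℂ × ℂ, AnalyticAt ℂ Ψ (Φ p) ∧ Ψ (Φ p) = p ∧
      ∀ᶠ w in 𝓝 (Φ p), Φ (Ψ w) = w := by
  have hi : Function.Injective (fderiv ℂ Φ p).toLinearMap := by
    rw [← LinearMap.ker_eq_bot, LinearMap.ker_eq_bot']
    exact hinj
  let e : (ℂ × ℂ) ≃L[ℂ] (ℂ × ℂ) :=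
    (LinearEquiv.ofInjectiveEndo _ hi).toContinuousLinearEquiv
  have he : (e : ℂ × ℂ →L[ℂ] ℂ × ℂ) = fderiv ℂ Φ p := by
    ext <;> simp [e]
  have hd : HasFDerivAt Φ (e : ℂ × ℂ →L[ℂ] ℂ × ℂ) p := by
    rw [he]; exact hΦ.differentiableAt.hasFDerivAt
  have hc : ContDiffAt ℂ ⊤ Φ p := hΦ.contDiffAt
  have hs := hc.hasStrictFDerivAt' hd (by simp)
  refine ⟨hc.localInverse hd (by simp), (hc.to_localInverse hd (by simp)).analyticAt,
    hc.localInverse_apply_image hd (by simp), ?_⟩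
  exact hs.eventually_right_inverse

theorem implicit_thm {F : ℂ × ℂ → ℂ} {s₀ y₀ a : ℂ} (hF : AnalyticAt ℂ F (s₀, y₀))
    (h0 : F (s₀, y₀) = 0) (ha : a ≠ 0) (hd : HasDerivAt (fun s => F (s, y₀)) a s₀) :
    ∃ S : ℂ → ℂ, AnalyticAt ℂ S y₀ ∧ S y₀ = s₀ ∧ ∀ᶠ y in 𝓝 y₀, F (S y, y) = 0 := by
  have hΦ : AnalyticAt ℂ (fun z : ℂ × ℂ => (F z, z.2)) (s₀, y₀) := hF.prod analyticAt_snd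
  have hFd := hF.differentiableAt.hasFDerivAt
  have hfd := (hFd.prodMk (hasFDerivAt_snd (𝕜 := ℂ) (p := (s₀, y₀)))).fderiv
  have ha' : fderiv ℂ F (s₀, y₀) (1, 0) = a := by
    have h1 : HasDerivAt (fun s : ℂ => (s, y₀)) ((1, 0) : ℂ × ℂ) s₀ :=
      (hasDerivAt_id s₀).prodMk (hasDerivAt_const _ _)
    exact (HasFDerivAt.comp_hasDerivAt (f := fun s : ℂ => (s, y₀)) s₀ hFd h1).unique hd
  obtain ⟨Ψ, h1, h2, h3⟩ := inverse_thm hΦ (by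
    rintro ⟨v1, v2⟩ hv
    rw [hfd] at hv
    have hv2 : v2 = 0 := by simpa using congrArg Prod.snd hv
    have hv1 : fderiv ℂ F (s₀, y₀) (v1, v2) = 0 := by simpa using congrArg Prod.fst hv
    subst hv2
    have : ((v1, 0) : ℂ × ℂ) = v1 • ((1, 0) : ℂ × ℂ) := by simp
    rw [this, map_smul, ha', smul_eq_mul] at hv1
    have : v1 = 0 := by simpa [ha] using hv1
    simp [this])
  simp only [h0] at h1 h2 h3
  have hcurve : AnalyticAt ℂ (fun y : ℂ => ((0 : ℂ), y)) y₀ := analyticAt_const.prod analyticAt_id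
  refine ⟨fun y => (Ψ (0, y)).1, ?_, by simp [h2], ?_⟩
  · exact analyticAt_fst.comp (AnalyticAt.comp (f := fun y : ℂ => ((0 : ℂ), y)) h1 hcurve)
  · have ht : Tendsto (fun y : ℂ => ((0 : ℂ), y)) (𝓝 y₀) (𝓝 (0, y₀)) := hcurve.continuousAt
    filter_upwards [ht.eventually h3] with y hy
    have e2 : (Ψ (0, y)).2 = y := congrArg Prod.snd hy
    have e1 : F (Ψ (0, y)) = 0 := congrArg Prod.fst hy
    have : ((Ψ (0, y)).1, y) = Ψ (0, y) := Prod.ext rfl e2.symm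
    rw [this, e1]

theorem cancel_pow {f g : ℂ → ℂ} (n : ℕ) (hf : ContinuousAt f 0) (hg : ContinuousAt g 0)
    (h : ∀ᶠ x in 𝓝 (0 : ℂ), x ^ n * f x = x ^ n * g x) : f 0 = g 0 := by
  have h1 : f =ᶠ[𝓝[≠] 0] g := by
    filter_upwards [h.filter_mono nhdsWithin_le_nhds, self_mem_nhdsWithin] with x hx hx0
    exact mul_left_cancel₀ (pow_ne_zero _ hx0) hx
  exact tendsto_nhds_unique_of_eventuallyEq (hf.tendsto.mono_left nhdsWithin_le_nhds)
    (hg.tendsto.mono_left nhdsWithin_le_nhds) h1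

theorem cancel_pow_ev {f g : ℂ → ℂ} (n : ℕ) (hf : ContinuousAt f 0) (hg : ContinuousAt g 0)
    (h : ∀ᶠ x in 𝓝 (0 : ℂ), x ^ n * f x = x ^ n * g x) : ∀ᶠ x in 𝓝 (0 : ℂ), f x = g x := by
  have h0 := cancel_pow n hf hg h
  filter_upwards [h] with x hx
  by_cases hx0 : x = 0
  · rw [hx0, h0]
  · exact mul_left_cancel₀ (pow_ne_zero _ hx0) hx

theorem div_pow_of_iteratedDeriv {f : ℂ → ℂ} (n : ℕ) (hf : AnalyticAt ℂ f 0)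
    (h : ∀ i < n, iteratedDeriv i f 0 = 0) :
    ∃ g : ℂ → ℂ, AnalyticAt ℂ g 0 ∧ ∀ᶠ z in 𝓝 (0 : ℂ), f z = z ^ n * g z := by
  have := (natCast_le_analyticOrderAt_iff_iteratedDeriv_eq_zero hf).2 h
  simpa using (natCast_le_analyticOrderAt hf).1 this

theorem exists_root {E : Type*} [NormedAddCommGroup E] [NormedSpace ℂ E] {f : E → ℂ} {x : E}
    (hf : AnalyticAt ℂ f x) (h0 : f x ≠ 0) {n : ℕ} (hn : n ≠ 0) :
    ∃ r : E → ℂ, AnalyticAt ℂ r x ∧ r x ≠ 0 ∧ ∀ z, r z ^ n = f z := by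
  have ha : AnalyticAt ℂ (fun z => (f x) ^ ((n : ℂ)⁻¹) * (f z / f x) ^ ((n : ℂ)⁻¹)) x := by
    refine analyticAt_const.mul (AnalyticAt.cpow (hf.div analyticAt_const h0) analyticAt_const ?_)
    simp [div_self h0]
  have hr : ∀ z, ((f x) ^ ((n : ℂ)⁻¹) * (f z / f x) ^ ((n : ℂ)⁻¹)) ^ n = f z := by
    intro z
    rw [mul_pow, Complex.cpow_nat_inv_pow _ hn, Complex.cpow_nat_inv_pow _ hn]
    field_simp
  refine ⟨_, ha, ?_, hr⟩
  intro h
  have := hr x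
  rw [h, zero_pow hn] at this
  exact h0 this.symm

theorem iteratedDeriv_of_taylor {f g : ℂ → ℂ} {a b c : ℂ} (hg : AnalyticAt ℂ g 0)
    (h : ∀ᶠ y in 𝓝 (0 : ℂ), f y = a + y * (b + y * (c + y * g y))) :
    iteratedDeriv 0 f 0 = a ∧ iteratedDeriv 1 f 0 = b ∧ iteratedDeriv 2 f 0 = 2 * c := by
  have hga : AnalyticAt ℂ (fun y => y ^ 3 * g y) 0 := (analyticAt_id.pow 3).mul hg
  have hv : ∀ i < 3, iteratedDeriv i (fun y => y ^ 3 * g y) 0 = 0 := by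
    refine (natCast_le_analyticOrderAt_iff_iteratedDeriv_eq_zero hga).1 ?_
    exact (natCast_le_analyticOrderAt hga).2 ⟨g, hg, Eventually.of_forall fun z => by simp⟩
  have hE : f =ᶠ[𝓝 0] (fun y => a + b * y + c * y ^ 2) + (fun y => y ^ 3 * g y) := by
    filter_upwards [h] with y hy
    rw [hy, Pi.add_apply]; ring
  have hp : ContDiff ℂ ⊤ (fun y : ℂ => a + b * y + c * y ^ 2) := by fun_prop
  have hi : ∀ i < 3, iteratedDeriv i f 0 = iteratedDeriv i (fun y => a + b * y + c * y ^ 2) 0 := by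
    intro i hi
    rw [hE.iteratedDeriv_eq i, iteratedDeriv_add (hp.contDiffAt.of_le le_top) hga.contDiffAt,
      hv i hi, add_zero]
  have hd1 : deriv (fun y : ℂ => a + b * y + c * y ^ 2) = fun y => b + 2 * c * y := by
    funext y
    have : HasDerivAt (fun y : ℂ => a + b * y + c * y ^ 2) (0 + b * 1 + c * (2 * y ^ 1 * 1)) y :=
      ((hasDerivAt_const _ _).add ((hasDerivAt_id y).const_mul b)).add
        (((hasDerivAt_id y).pow 2).const_mul c)
    rw [this.deriv]; ring
  have hd2 : deriv (fun y : ℂ => b + 2 * c * y) = fun _ => 2 * c := by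
    funext y
    have : HasDerivAt (fun y : ℂ => b + 2 * c * y) (0 + 2 * c * 1) y :=
      (hasDerivAt_const _ _).add ((hasDerivAt_id y).const_mul _)
    rw [this.deriv]; ring
  refine ⟨?_, ?_, ?_⟩
  · rw [hi 0 (by norm_num)]; simp
  · rw [hi 1 (by norm_num), iteratedDeriv_one, hd1]; simp
  · rw [hi 2 (by norm_num), iteratedDeriv_succ, iteratedDeriv_one, hd1, hd2]

theorem tendsto_xaxis : Tendsto (fun x : ℂ => (x, (0 : ℂ))) (𝓝 0) (𝓝 0) := by
  have : Continuous (fun x : ℂ => (x, (0 : ℂ))) := by fun_prop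
  exact this.tendsto' _ _ rfl

theorem tendsto_yaxis : Tendsto (fun x : ℂ => ((0 : ℂ), x)) (𝓝 0) (𝓝 0) := by
  have : Continuous (fun x : ℂ => ((0 : ℂ), x)) := by fun_prop
  exact this.tendsto' _ _ rfl

/-- composition of an analytic function at the origin with an analytic pair. -/
theorem comp_pair {E : Type*} [NormedAddCommGroup E] [NormedSpace ℂ E] {f : ℂ × ℂ → ℂ}
    {a b : E → ℂ} {x : E} (hf : AnalyticAt ℂ f 0) (ha : AnalyticAt ℂ a x) (hb : AnalyticAt ℂ b x)
    (ha0 : a x = 0) (hb0 : b x = 0) : AnalyticAt ℂ (fun z => f (a z, b z)) x := by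
  refine AnalyticAt.fun_comp (g := f) (f := fun z => (a z, b z)) ?_ (ha.prod hb)
  rw [ha0, hb0]; exact hf

theorem comp_one {E : Type*} [NormedAddCommGroup E] [NormedSpace ℂ E] {f : ℂ → ℂ}
    {a : E → ℂ} {x : E} (hf : AnalyticAt ℂ f 0) (ha : AnalyticAt ℂ a x)
    (ha0 : a x = 0) : AnalyticAt ℂ (fun z => f (a z)) x := by
  refine AnalyticAt.fun_comp (g := f) (f := a) ?_ ha
  rw [ha0]; exact hf

theorem analyticAt_xaxis {f : ℂ × ℂ → ℂ} (hf : AnalyticAt ℂ f 0) :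
    AnalyticAt ℂ (fun x => f (x, 0)) 0 :=
  comp_pair hf analyticAt_id analyticAt_const rfl rfl

theorem eventually_slice {p : ℂ × ℂ → Prop} (h : ∀ᶠ z in 𝓝 (0 : ℂ × ℂ), p z) :
    ∀ᶠ x in 𝓝 (0 : ℂ), ∀ᶠ y in 𝓝 (0 : ℂ), p (x, y) := by
  have : ∀ᶠ z in 𝓝 (0 : ℂ) ×ˢ 𝓝 (0 : ℂ), p z := by rw [← nhds_prod_eq]; exact h
  exact this.curry

theorem prep1 {ρ : ℂ × ℂ → ℂ} (hρ : AnalyticAt ℂ ρ 0)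
    (h00 : pd 0 0 ρ = 0) (h10 : pd 1 0 ρ = 0) (h01 : pd 0 1 ρ = 0)
    (h20 : pd 2 0 ρ = 0) (h11 : pd 1 1 ρ = 0) (h02 : pd 0 2 ρ = 0)
    (h30 : pd 3 0 ρ = 0) (h21 : pd 2 1 ρ = 0) (h12 : pd 1 2 ρ ≠ 0) :
    ∃ (P Q B : ℂ → ℂ) (G : ℂ × ℂ → ℂ), AnalyticAt ℂ P 0 ∧ AnalyticAt ℂ Q 0 ∧ AnalyticAt ℂ B 0 ∧
      AnalyticAt ℂ G 0 ∧ B 0 ≠ 0 ∧ ∀ᶠ z in 𝓝 (0 : ℂ × ℂ),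
        ρ z = z.1 ^ 4 * P z.1 + z.2 * z.1 ^ 3 * Q z.1 + z.2 ^ 2 * z.1 * B z.1 + z.2 ^ 3 * G z := by
  obtain ⟨g1, hg1, e1⟩ := hadamardY hρ
  obtain ⟨g2, hg2, e2⟩ := hadamardY hg1
  obtain ⟨g3, hg3, e3⟩ := hadamardY hg2
  have hA0 := analyticAt_xaxis hρ
  have hA1 := analyticAt_xaxis hg1
  have hA2 := analyticAt_xaxis hg2
  have hall : ∀ᶠ z in 𝓝 (0 : ℂ × ℂ), ρ z = ρ (z.1, 0) + z.2 * (g1 (z.1, 0) + z.2 *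
      (g2 (z.1, 0) + z.2 * g3 z)) := by
    filter_upwards [e1, e2, e3] with z h1 h2 h3
    rw [h1, h2, h3]
  have hder : ∀ᶠ x in 𝓝 (0 : ℂ),
      iteratedDeriv 0 (fun y => ρ (x, y)) 0 = ρ (x, 0) ∧
      iteratedDeriv 1 (fun y => ρ (x, y)) 0 = g1 (x, 0) ∧
      iteratedDeriv 2 (fun y => ρ (x, y)) 0 = 2 * g2 (x, 0) := by
    filter_upwards [eventually_slice hall, tendsto_xaxis.eventually hg3.eventually_analyticAt]
      with x hx hgx
    refine iteratedDeriv_of_taylor (g := fun y => g3 (x, y)) ?_ hx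
    exact AnalyticAt.fun_comp (g := g3) (f := fun y => (x, y)) hgx (analyticAt_const.prod analyticAt_id)
  have p0 : ∀ i, pd i 0 ρ = iteratedDeriv i (fun x => ρ (x, 0)) 0 := fun i =>
    Filter.EventuallyEq.iteratedDeriv_eq i (hder.mono fun x hx => hx.1)
  have p1 : ∀ i, pd i 1 ρ = iteratedDeriv i (fun x => g1 (x, 0)) 0 := fun i =>
    Filter.EventuallyEq.iteratedDeriv_eq i (hder.mono fun x hx => hx.2.1)
  have p2 : ∀ i, pd i 2 ρ = iteratedDeriv i (fun x => 2 * g2 (x, 0)) 0 := fun i =>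
    Filter.EventuallyEq.iteratedDeriv_eq i (hder.mono fun x hx => hx.2.2)
  obtain ⟨P, hP, eP⟩ := div_pow_of_iteratedDeriv 4 hA0 (by
    intro i hi
    rw [← p0]
    interval_cases i <;> assumption)
  obtain ⟨Q, hQ, eQ⟩ := div_pow_of_iteratedDeriv 3 hA1 (by
    intro i hi
    rw [← p1]
    interval_cases i <;> assumption)
  have hA2' : AnalyticAt ℂ (fun x => 2 * g2 (x, 0)) 0 := analyticAt_const.mul hA2
  obtain ⟨B, hB, eB⟩ := div_pow_of_iteratedDeriv 1 hA2' (by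
    intro i hi
    rw [← p2]
    interval_cases i <;> assumption)
  refine ⟨P, Q, fun x => B x / 2, g3, hP, hQ, hB.div analyticAt_const two_ne_zero, hg3, ?_, ?_⟩
  · intro hB0
    apply h12
    rw [p2, Filter.EventuallyEq.iteratedDeriv_eq 1 eB, iteratedDeriv_one]
    have : HasDerivAt (fun z => z ^ 1 * B z) (1 * B 0 + 0 * deriv B 0) 0 := by
      simp only [pow_one]
      exact (hasDerivAt_id (0 : ℂ)).mul hB.differentiableAt.hasDerivAt
    rw [this.deriv]
    have : B 0 = 0 := by simpa using hB0
    simp [this]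
  · have hfst : Tendsto (fun z : ℂ × ℂ => z.1) (𝓝 0) (𝓝 0) := continuous_fst.tendsto' _ _ rfl
    filter_upwards [hall, hfst.eventually eP, hfst.eventually eQ, hfst.eventually eB]
      with z h hp hq hb
    rw [h, hp, hq]
    linear_combination (z.2 ^ 2 / 2) * hb

theorem prep2 {ρ : ℂ × ℂ → ℂ} {P Q B : ℂ → ℂ} {G : ℂ × ℂ → ℂ} (hρ : AnalyticAt ℂ ρ 0)
    (hP : AnalyticAt ℂ P 0) (hQ : AnalyticAt ℂ Q 0) (hB : AnalyticAt ℂ B 0) (hG : AnalyticAt ℂ G 0)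
    (hB0 : B 0 ≠ 0) (hρe : ∀ᶠ z in 𝓝 (0 : ℂ × ℂ),
        ρ z = z.1 ^ 4 * P z.1 + z.2 * z.1 ^ 3 * Q z.1 + z.2 ^ 2 * z.1 * B z.1 + z.2 ^ 3 * G z) :
    ∃ (S R : ℂ → ℂ) (E : ℂ × ℂ → ℂ), AnalyticAt ℂ S 0 ∧ AnalyticAt ℂ R 0 ∧ AnalyticAt ℂ E 0 ∧
      E 0 ≠ 0 ∧ ∀ᶠ z in 𝓝 (0 : ℂ × ℂ), ρ (z.1 + z.2 * S z.2, z.2) =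
        z.1 * (z.1 ^ 3 * P z.1 + z.2 * z.1 ^ 2 * R z.1 + z.2 ^ 2 * E z) := by
  let F : ℂ × ℂ → ℂ := fun w => w.2 * w.1 ^ 4 * P (w.2 * w.1) + w.2 * w.1 ^ 3 * Q (w.2 * w.1) +
    w.1 * B (w.2 * w.1) + G (w.2 * w.1, w.2)
  have hF : ∀ s, AnalyticAt ℂ F (s, 0) := by
    intro s
    have f1 : AnalyticAt ℂ (fun w : ℂ × ℂ => w.1) (s, 0) := analyticAt_fst
    have f2 : AnalyticAt ℂ (fun w : ℂ × ℂ => w.2) (s, 0) := analyticAt_snd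
    have f3 : AnalyticAt ℂ (fun w : ℂ × ℂ => w.2 * w.1) (s, 0) := f2.mul f1
    have z3 : (fun w : ℂ × ℂ => w.2 * w.1) (s, (0 : ℂ)) = 0 := by simp
    exact ((((f2.mul (f1.pow 4)).mul (comp_one hP f3 z3)).add
      ((f2.mul (f1.pow 3)).mul (comp_one hQ f3 z3))).add
      (f1.mul (comp_one hB f3 z3))).add (comp_pair hG f3 f2 z3 rfl)
  have hFs : ∀ s, F (s, 0) = s * B 0 + G 0 := by
    intro s; simp [F, Prod.mk_zero_zero]
  obtain ⟨S, hS, hS0, hSe⟩ := implicit_thm (hF (-G 0 / B 0)) (by rw [hFs]; field_simp; ring) hB0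
    (by
      simp only [hFs]
      simpa using ((hasDerivAt_id (-G 0 / B 0)).mul_const (B 0)).add_const (G 0))
  have hS2 : AnalyticAt ℂ (fun z : ℂ × ℂ => S z.2) 0 := comp_one hS analyticAt_snd rfl
  have hx : AnalyticAt ℂ (fun z : ℂ × ℂ => z.1 + z.2 * S z.2) 0 :=
    analyticAt_fst.add (analyticAt_snd.mul hS2)
  have hρ1 : AnalyticAt ℂ (fun z : ℂ × ℂ => ρ (z.1 + z.2 * S z.2, z.2)) 0 :=
    comp_pair hρ hx analyticAt_snd (by simp) rfl
  have hmapT : Tendsto (fun z : ℂ × ℂ => (z.1 + z.2 * S z.2, z.2)) (𝓝 0) (𝓝 0) := by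
    have := (hx.prod (analyticAt_snd (𝕜 := ℂ) (p := (0 : ℂ × ℂ)))).continuousAt.tendsto
    simpa [Prod.mk_zero_zero] using this
  -- scaling identity
  have hscale : ∀ t : ℂ, ∀ᶠ y in 𝓝 (0 : ℂ),
      ρ (t * y + y * S y, y) = y ^ 3 * F (t + S y, y) := by
    intro t
    have hl : Tendsto (fun y : ℂ => (t * y, y)) (𝓝 0) (𝓝 0) := by
      have : Continuous (fun y : ℂ => (t * y, y)) := by fun_prop
      exact this.tendsto' _ _ (by simp)
    filter_upwards [(hmapT.comp hl).eventually hρe] with y hy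
    simp only [Function.comp_apply] at hy
    rw [hy]
    have : y * (t + S y) = t * y + y * S y := by ring
    simp only [F, this]
    rw [← this]
    ring
  have hzero : ∀ᶠ y in 𝓝 (0 : ℂ), ρ (0 + y * S y, y) = 0 := by
    filter_upwards [hscale 0, hSe] with y h1 h2
    rw [zero_mul] at h1
    rw [h1, zero_add, h2, mul_zero]
  -- divide by x
  have hsw : AnalyticAt ℂ (fun z : ℂ × ℂ => ρ (z.2 + z.1 * S z.1, z.1)) 0 :=
    comp_pair (f := fun z : ℂ × ℂ => ρ (z.1 + z.2 * S z.2, z.2)) hρ1 analyticAt_snd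
      analyticAt_fst rfl rfl
  obtain ⟨q', hq', eq'⟩ := hadamardY hsw
  have hswT : Tendsto (fun z : ℂ × ℂ => (z.2, z.1)) (𝓝 0) (𝓝 0) := by
    have : Continuous (fun z : ℂ × ℂ => (z.2, z.1)) := by fun_prop
    exact this.tendsto' _ _ rfl
  have hq : AnalyticAt ℂ (fun z : ℂ × ℂ => q' (z.2, z.1)) 0 :=
    comp_pair hq' analyticAt_snd analyticAt_fst rfl rfl
  obtain ⟨g, hg, eg⟩ := hadamardY hq
  obtain ⟨E, hE, eE⟩ := hadamardY hg
  have hfst : Tendsto (fun z : ℂ × ℂ => z.1) (𝓝 0) (𝓝 0) := continuous_fst.tendsto' _ _ rfl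
  have hsnd : Tendsto (fun z : ℂ × ℂ => z.2) (𝓝 0) (𝓝 0) := continuous_snd.tendsto' _ _ rfl
  have hdec : ∀ᶠ z in 𝓝 (0 : ℂ × ℂ), ρ (z.1 + z.2 * S z.2, z.2) =
      z.1 * (q' (0, z.1) + z.2 * (g (z.1, 0) + z.2 * E z)) := by
    filter_upwards [hswT.eventually eq', hsnd.eventually hzero, eg, eE] with z h1 h2 h3 h4
    rw [h1, h2, h3, h4]; ring
  have hc0 : ∀ᶠ x in 𝓝 (0 : ℂ), q' (0, x) = x ^ 3 * P x := by
    refine cancel_pow_ev 1 (analyticAt_xaxis hq).continuousAt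
      ((analyticAt_id.pow 3).mul hP).continuousAt ?_
    filter_upwards [tendsto_xaxis.eventually hdec, tendsto_xaxis.eventually hρe] with x h1 h2
    simp only [zero_mul, add_zero] at h1 h2
    rw [h2] at h1
    linear_combination -h1
  have hc1 := analyticAt_xaxis hg
  have hlin : ∀ t : ℂ, AnalyticAt ℂ (fun y : ℂ => t * y) 0 := fun t =>
    analyticAt_const.mul analyticAt_id
  have hlT : ∀ t : ℂ, Tendsto (fun y : ℂ => (t * y, y)) (𝓝 0) (𝓝 0) := by
    intro t
    have : Continuous (fun y : ℂ => (t * y, y)) := by fun_prop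
    exact this.tendsto' _ _ (by simp)
  have hlT1 : ∀ t : ℂ, Tendsto (fun y : ℂ => t * y) (𝓝 0) (𝓝 0) := by
    intro t
    have : Continuous (fun y : ℂ => t * y) := by fun_prop
    exact this.tendsto' _ _ (by simp)
  have hFc : ∀ t : ℂ, AnalyticAt ℂ (fun y : ℂ => F (t + S y, y)) 0 := by
    intro t
    refine AnalyticAt.fun_comp (g := F) (f := fun y : ℂ => (t + S y, y)) (hF _) ?_
    exact (analyticAt_const.add hS).prod analyticAt_id
  have hrel : ∀ t : ℂ, ∀ᶠ y in 𝓝 (0 : ℂ), y ^ 3 * F (t + S y, y) =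
      (t * y) * ((t * y) ^ 3 * P (t * y) + y * (g (t * y, 0) + y * E (t * y, y))) := by
    intro t
    filter_upwards [hscale t, (hlT t).eventually hdec, (hlT1 t).eventually hc0] with y h1 h2 h3
    rw [← h1]
    simp only [h3] at h2
    exact h2
  have hg0 : g (0, 0) = 0 := by
    have hEa : AnalyticAt ℂ (fun y : ℂ => E (1 * y, y)) 0 :=
      comp_pair hE (hlin 1) analyticAt_id (by simp) rfl
    have hga : AnalyticAt ℂ (fun y : ℂ => g (1 * y, 0)) 0 :=
      comp_pair hg (hlin 1) analyticAt_const (by simp) rfl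
    have hPa : AnalyticAt ℂ (fun y : ℂ => P (1 * y)) 0 := comp_one hP (hlin 1) (by simp)
    have hy : AnalyticAt ℂ (fun y : ℂ => y) 0 := analyticAt_id
    have := cancel_pow (f := fun y => y * F (1 + S y, y))
      (g := fun y => y ^ 2 * P (1 * y) + (g (1 * y, 0) + y * E (1 * y, y))) 2
      (hy.mul (hFc 1)).continuousAt
      (((hy.pow 2).mul hPa).add (hga.add (hy.mul hEa))).continuousAt (by
        filter_upwards [hrel 1] with y h
        linear_combination h)
    simpa using this.symm
  obtain ⟨c2, hc2, ec2⟩ := div_pow_of_iteratedDeriv 1 hc1 (by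
    intro i hi
    interval_cases i
    simpa using hg0)
  have hval : ∀ t : ℂ, t * B 0 = t * (t * c2 0 + E 0) := by
    intro t
    have hEa : AnalyticAt ℂ (fun y : ℂ => E (t * y, y)) 0 :=
      comp_pair hE (hlin t) analyticAt_id (by simp) rfl
    have hca : AnalyticAt ℂ (fun y : ℂ => c2 (t * y)) 0 := comp_one hc2 (hlin t) (by simp)
    have hPa : AnalyticAt ℂ (fun y : ℂ => P (t * y)) 0 := comp_one hP (hlin t) (by simp)
    have hy : AnalyticAt ℂ (fun y : ℂ => y) 0 := analyticAt_id
    have := cancel_pow (f := fun y => F (t + S y, y))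
      (g := fun y => t * (t ^ 3 * y * P (t * y) + (t * c2 (t * y) + E (t * y, y)))) 3
      (hFc t).continuousAt
      (analyticAt_const.mul (((analyticAt_const.mul hy).mul hPa).add
        ((analyticAt_const.mul hca).add hEa))).continuousAt (by
        filter_upwards [hrel t, (hlT1 t).eventually ec2] with y h h2
        rw [h2] at h
        linear_combination h)
    simp only [hS0, hFs, mul_zero, zero_mul, zero_add, Prod.mk_zero_zero] at this
    rw [← this]
    field_simp
    ring
  have hv1 := hval 1
  have hv2 := hval (-1)
  have hE0 : E 0 = B 0 := by linear_combination (-1 / 2) * hv1 + (1 / 2) * hv2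
  have hc20 : c2 0 = 0 := by linear_combination (-1 / 2) * hv1 - (1 / 2) * hv2
  obtain ⟨R, hR, eR⟩ := div_pow_of_iteratedDeriv 1 hc2 (by
    intro i hi
    interval_cases i
    simpa using hc20)
  refine ⟨S, R, E, hS, hR, hE, hE0 ▸ hB0, ?_⟩
  filter_upwards [hdec, hfst.eventually hc0, hfst.eventually ec2, hfst.eventually eR]
    with z h1 h2 h3 h4
  rw [h1, h2, h3, h4]; ring

theorem prep3 {P R : ℂ → ℂ} {E : ℂ × ℂ → ℂ}
    (hP : AnalyticAt ℂ P 0) (hR : AnalyticAt ℂ R 0) (hE : AnalyticAt ℂ E 0) (hE0 : E 0 ≠ 0) :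
    ∃ (Y c : ℂ → ℂ) (e : ℂ × ℂ → ℂ), AnalyticAt ℂ Y 0 ∧ Y 0 = 0 ∧ AnalyticAt ℂ c 0 ∧
      AnalyticAt ℂ e 0 ∧ e 0 ≠ 0 ∧ ∀ᶠ z in 𝓝 (0 : ℂ × ℂ),
        z.1 ^ 3 * P z.1 + (z.2 + Y z.1) * z.1 ^ 2 * R z.1 + (z.2 + Y z.1) ^ 2 * E (z.1, z.2 + Y z.1)
          = z.1 ^ 3 * c z.1 + z.2 ^ 2 * e z := by
  let D : ℂ × ℂ → ℂ := fun z => fderiv ℂ E z (0, 1)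
  have hD : AnalyticAt ℂ D 0 :=
    ((ContinuousLinearMap.apply ℂ ℂ ((0, 1) : ℂ × ℂ)).analyticAt _).comp hE.fderiv
  -- `H (y, x)` is the `y`-derivative
  let H : ℂ × ℂ → ℂ := fun w => w.2 ^ 2 * R w.2 + w.1 * (2 * E (w.2, w.1) + w.1 * D (w.2, w.1))
  have f1 : AnalyticAt ℂ (fun w : ℂ × ℂ => w.1) 0 := analyticAt_fst
  have f2 : AnalyticAt ℂ (fun w : ℂ × ℂ => w.2) 0 := analyticAt_snd
  have hEs : AnalyticAt ℂ (fun w : ℂ × ℂ => E (w.2, w.1)) 0 := comp_pair hE f2 f1 rfl rfl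
  have hDs : AnalyticAt ℂ (fun w : ℂ × ℂ => D (w.2, w.1)) 0 := comp_pair hD f2 f1 rfl rfl
  have hRs : AnalyticAt ℂ (fun w : ℂ × ℂ => R w.2) 0 := comp_one hR f2 rfl
  have hH : AnalyticAt ℂ H (0, 0) :=
    ((f2.pow 2).mul hRs).add (f1.mul ((analyticAt_const.mul hEs).add (f1.mul hDs)))
  have hy : AnalyticAt ℂ (fun y : ℂ => y) 0 := analyticAt_id
  have hH1 : HasDerivAt (fun s => H (s, 0)) (2 * E 0) 0 := by
    have hk : AnalyticAt ℂ (fun s : ℂ => 2 * E (0, s) + s * D (0, s)) 0 :=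
      (analyticAt_const.mul (comp_pair hE analyticAt_const hy rfl rfl)).add
        (hy.mul (comp_pair hD analyticAt_const hy rfl rfl))
    have h1 := (hasDerivAt_id (0 : ℂ)).mul hk.differentiableAt.hasDerivAt
    convert! h1 using 1
    · funext s; simp [H]
    · simp [Prod.mk_zero_zero]
  obtain ⟨Y, hY, hY0, hYe⟩ := implicit_thm hH (by simp [H]) (mul_ne_zero two_ne_zero hE0) hH1
  -- `Y = x ^ 2 * W`
  let K : ℂ → ℂ := fun x => 2 * E (x, Y x) + Y x * D (x, Y x)
  have hEY : AnalyticAt ℂ (fun x => E (x, Y x)) 0 := comp_pair hE hy hY rfl hY0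
  have hDY : AnalyticAt ℂ (fun x => D (x, Y x)) 0 := comp_pair hD hy hY rfl hY0
  have hK : AnalyticAt ℂ K 0 := (analyticAt_const.mul hEY).add (hY.mul hDY)
  have hK0 : K 0 ≠ 0 := by simp [K, hY0, Prod.mk_zero_zero, hE0]
  let W : ℂ → ℂ := fun x => -R x / K x
  have hW : AnalyticAt ℂ W 0 := hR.neg.div hK hK0
  have hYW : ∀ᶠ x in 𝓝 (0 : ℂ), Y x = x ^ 2 * W x := by
    filter_upwards [hYe, hK.continuousAt.eventually_ne hK0] with x h1 h2
    have h3 : x ^ 2 * R x + Y x * K x = 0 := h1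
    simp only [W]
    field_simp
    linear_combination h3
  -- Taylor expansion around `Y`
  have hYs : AnalyticAt ℂ (fun z : ℂ × ℂ => z.2 + Y z.1) 0 := f2.add (comp_one hY f1 rfl)
  have hYs0 : (fun z : ℂ × ℂ => z.2 + Y z.1) 0 = 0 := by simp [hY0]
  have hEYs : AnalyticAt ℂ (fun z : ℂ × ℂ => E (z.1, z.2 + Y z.1)) 0 := comp_pair hE f1 hYs rfl hYs0
  let q : ℂ × ℂ → ℂ := fun z => z.1 ^ 3 * P z.1 + (z.2 + Y z.1) * z.1 ^ 2 * R z.1 +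
    (z.2 + Y z.1) ^ 2 * E (z.1, z.2 + Y z.1)
  have hq : AnalyticAt ℂ q 0 :=
    (((f1.pow 3).mul (comp_one hP f1 rfl)).add ((hYs.mul (f1.pow 2)).mul (comp_one hR f1 rfl))).add
      ((hYs.pow 2).mul hEYs)
  obtain ⟨g, hg, eg⟩ := hadamardY hq
  obtain ⟨e, he, ee⟩ := hadamardY hg
  have hcurve : Tendsto (fun x : ℂ => (x, Y x)) (𝓝 0) (𝓝 0) := by
    have := (hy.prod hY).continuousAt.tendsto
    simpa [hY0, Prod.mk_zero_zero] using this
  have hg0 : ∀ᶠ x in 𝓝 (0 : ℂ), g (x, 0) = 0 := by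
    filter_upwards [eventually_slice eg, tendsto_xaxis.eventually hg.eventually_analyticAt,
      hcurve.eventually hE.eventually_analyticAt, hYe] with x h1 h2 h3 h4
    have d1 : HasDerivAt (fun y => q (x, y)) (g (x, 0)) 0 := by
      have hgx : DifferentiableAt ℂ (fun y => g (x, y)) 0 :=
        (AnalyticAt.fun_comp (g := g) (f := fun y => (x, y)) h2
          (analyticAt_const.prod analyticAt_id)).differentiableAt
      have := ((hasDerivAt_id (0 : ℂ)).mul hgx.hasDerivAt).const_add (q (x, 0))
      have h5 : HasDerivAt (fun y => q (x, 0) + y * g (x, y)) (g (x, 0)) 0 := by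
        convert! this using 1
        simp
      exact h5.congr_of_eventuallyEq h1
    have d2 : HasDerivAt (fun y => q (x, y)) (H (Y x, x)) 0 := by
      have l1 : HasDerivAt (fun y : ℂ => y + Y x) 1 0 := (hasDerivAt_id (0 : ℂ)).add_const _
      have l2 : HasDerivAt (fun y : ℂ => (x, y + Y x)) ((0, 1) : ℂ × ℂ) 0 :=
        (hasDerivAt_const _ _).prodMk l1
      have l3 : HasDerivAt (fun y : ℂ => E (x, y + Y x)) (D (x, Y x)) 0 := by
        have h6 : HasFDerivAt E (fderiv ℂ E (x, Y x)) (x, 0 + Y x) := by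
          rw [zero_add]; exact h3.differentiableAt.hasFDerivAt
        exact HasFDerivAt.comp_hasDerivAt (f := fun y : ℂ => (x, y + Y x)) 0 h6 l2
      have := (((l1.mul_const (x ^ 2)).mul_const (R x)).const_add (x ^ 3 * P x)).add
        ((l1.pow 2).mul l3)
      convert! this using 1
      simp [H]
      ring
    rw [d1.unique d2, h4]
  have he0 : e 0 = E 0 := by
    have := cancel_pow (f := fun y => e (0, y)) (g := fun y => E (0, y)) 2
      (comp_pair he analyticAt_const hy rfl rfl).continuousAt
      (comp_pair hE analyticAt_const hy rfl rfl).continuousAt (by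
        filter_upwards [tendsto_yaxis.eventually eg, tendsto_yaxis.eventually ee] with y h1 h2
        have h3 := hg0.self_of_nhds
        simp only [h3, zero_add] at h2
        rw [h2] at h1
        simp [q, hY0] at h1
        linear_combination -h1)
    simpa [Prod.mk_zero_zero] using this
  have hfst : Tendsto (fun z : ℂ × ℂ => z.1) (𝓝 0) (𝓝 0) := continuous_fst.tendsto' _ _ rfl
  refine ⟨Y, fun x => P x + x * W x * R x + x * W x ^ 2 * E (x, Y x), e, hY, hY0,
    (hP.add ((hy.mul hW).mul hR)).add ((hy.mul (hW.pow 2)).mul hEY), he, he0 ▸ hE0, ?_⟩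
  filter_upwards [eg, ee, hfst.eventually hg0, hfst.eventually hYW] with z h1 h2 h3 h4
  change q z = _
  rw [h1, h2, h3]
  simp only [q, zero_add]
  generalize E (z.1, Y z.1) = T
  rw [h4]
  ring

theorem prep4 {c : ℂ → ℂ} {e : ℂ × ℂ → ℂ} (hc : AnalyticAt ℂ c 0) (he : AnalyticAt ℂ e 0)
    (he0 : e 0 ≠ 0) :
    ∃ (α : ℂ → ℂ) (η : ℂ × ℂ → ℂ), AnalyticAt ℂ α 0 ∧ AnalyticAt ℂ η 0 ∧ α 0 ≠ 0 ∧ η 0 ≠ 0 ∧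
      ((∀ᶠ z in 𝓝 (0 : ℂ × ℂ), z.1 * (z.1 ^ 3 * c z.1 + z.2 ^ 2 * e z) =
          (z.2 * η z) ^ 2 * (z.1 * α z.1)) ∨
        ∃ k : ℕ, 5 ≤ k ∧ ∀ᶠ z in 𝓝 (0 : ℂ × ℂ), z.1 * (z.1 ^ 3 * c z.1 + z.2 ^ 2 * e z) =
          (z.2 * η z) ^ 2 * (z.1 * α z.1) + (z.1 * α z.1) ^ (k - 1)) := by
  have hfst : Tendsto (fun z : ℂ × ℂ => z.1) (𝓝 0) (𝓝 0) := continuous_fst.tendsto' _ _ rfl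
  by_cases ht : analyticOrderAt c 0 = ⊤
  · rw [analyticOrderAt_eq_top] at ht
    obtain ⟨η, hη, hη0, hηe⟩ := exists_root he he0 two_ne_zero
    refine ⟨fun _ => 1, η, analyticAt_const, hη, one_ne_zero, hη0, Or.inl ?_⟩
    filter_upwards [hfst.eventually ht] with z h
    rw [h, mul_pow, hηe]; ring
  · obtain ⟨d, hd, hd0, hde⟩ := (hc.analyticOrderAt_ne_top).1 ht
    set m := analyticOrderNatAt c 0
    obtain ⟨α, hα, hα0, hαe⟩ := exists_root hd hd0 (n := m + 4) (by omega)
    have hαs : AnalyticAt ℂ (fun z : ℂ × ℂ => α z.1) 0 := comp_one hα analyticAt_fst rfl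
    have hq : AnalyticAt ℂ (fun z : ℂ × ℂ => e z / α z.1) 0 := he.div hαs hα0
    obtain ⟨η, hη, hη0, hηe⟩ := exists_root hq (div_ne_zero he0 hα0) two_ne_zero
    refine ⟨α, η, hα, hη, hα0, hη0, Or.inr ⟨m + 5, by omega, ?_⟩⟩
    filter_upwards [hfst.eventually hde, hαs.continuousAt.eventually_ne hα0] with z h h2
    have : m + 5 - 1 = m + 4 := by omega
    rw [this, h, mul_pow, mul_pow, hηe, hαe, sub_zero, smul_eq_mul]
    field_simp
    ring

theorem stmt_8 (U : Set (ℂ × ℂ)) (hU : IsOpen U) (h0U : (0 : ℂ × ℂ) ∈ U)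
    (ρ : ℂ × ℂ → ℂ) (hρ : AnalyticOnNhd ℂ ρ U)
    (h00 : pd 0 0 ρ = 0) (h10 : pd 1 0 ρ = 0) (h01 : pd 0 1 ρ = 0)
    (h20 : pd 2 0 ρ = 0) (h11 : pd 1 1 ρ = 0) (h02 : pd 0 2 ρ = 0)
    (h30 : pd 3 0 ρ = 0) (h21 : pd 2 1 ρ = 0) (h12 : pd 1 2 ρ ≠ 0) :
    ∃ (V : Set (ℂ × ℂ)) (φ : ℂ × ℂ → ℂ × ℂ),
      IsOpen V ∧ (0 : ℂ × ℂ) ∈ V ∧ AnalyticOnNhd ℂ φ V ∧ φ 0 = 0 ∧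
      Set.InjOn φ V ∧ Set.MapsTo φ V U ∧
      ((∀ p ∈ V, ρ (φ p) = p.2 ^ 2 * p.1) ∨
        ∃ k : ℕ, 5 ≤ k ∧ ∀ p ∈ V, ρ (φ p) = p.2 ^ 2 * p.1 + p.1 ^ (k - 1)) := by
  have hρ0 := hρ 0 h0U
  obtain ⟨P, Q, B, G, hP, hQ, hB, hG, hB0, e1⟩ := prep1 hρ0 h00 h10 h01 h20 h11 h02 h30 h21 h12
  obtain ⟨S, R, E, hS, hR, hE, hE0, e2⟩ := prep2 hρ0 hP hQ hB hG hB0 e1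
  obtain ⟨Y, c, e, hY, hY0, hc, he, he0, e3⟩ := prep3 hP hR hE hE0
  obtain ⟨α, η, hα, hη, hα0, hη0, e4⟩ := prep4 hc he he0
  have f1 : AnalyticAt ℂ (fun w : ℂ × ℂ => w.1) 0 := analyticAt_fst
  have f2 : AnalyticAt ℂ (fun w : ℂ × ℂ => w.2) 0 := analyticAt_snd
  have hαs : AnalyticAt ℂ (fun z : ℂ × ℂ => α z.1) 0 := comp_one hα f1 rfl
  let D : ℂ × ℂ → ℂ × ℂ := fun z => (z.1 * α z.1, z.2 * η z)
  have hD : AnalyticAt ℂ D 0 := (f1.mul hαs).prod (f2.mul hη)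
  have hD0 : D 0 = 0 := by simp [D]
  have hDd : HasFDerivAt D _ 0 :=
    ((hasFDerivAt_fst (𝕜 := ℂ) (p := (0 : ℂ × ℂ))).mul hαs.differentiableAt.hasFDerivAt).prodMk
      ((hasFDerivAt_snd (𝕜 := ℂ) (p := (0 : ℂ × ℂ))).mul hη.differentiableAt.hasFDerivAt)
  obtain ⟨Ψ, hΨ, hΨ0, hΨe⟩ := inverse_thm hD (by
    intro v hv
    rw [hDd.fderiv] at hv
    have hv1 := congrArg Prod.fst hv
    have hv2 := congrArg Prod.snd hv
    simp [hα0, hη0] at hv1 hv2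
    exact Prod.ext hv1 hv2)
  rw [hD0] at hΨ hΨ0 hΨe
  let A : ℂ × ℂ → ℂ × ℂ := fun z => (z.1 + z.2 * S z.2, z.2)
  let T : ℂ × ℂ → ℂ × ℂ := fun z => (z.1, z.2 + Y z.1)
  have hA : AnalyticAt ℂ A 0 := (f1.add (f2.mul (comp_one hS f2 rfl))).prod f2
  have hT : AnalyticAt ℂ T 0 := f1.prod (f2.add (comp_one hY f1 rfl))
  have hA0 : A 0 = 0 := by simp [A]
  have hT0 : T 0 = 0 := by simp [T, hY0]
  have hAinj : Function.Injective A := by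
    rintro ⟨a, b⟩ ⟨a', b'⟩ h
    simp only [A, Prod.mk.injEq] at h
    obtain ⟨h1, rfl⟩ := h
    simpa using h1
  have hTinj : Function.Injective T := by
    rintro ⟨a, b⟩ ⟨a', b'⟩ h
    simp only [T, Prod.mk.injEq] at h
    obtain ⟨rfl, h1⟩ := h
    simpa using h1
  have hTΨ : AnalyticAt ℂ (fun w => T (Ψ w)) 0 :=
    AnalyticAt.fun_comp (g := T) (f := Ψ) (by rw [hΨ0]; exact hT) hΨ
  have hφ : AnalyticAt ℂ (fun w => A (T (Ψ w))) 0 :=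
    AnalyticAt.fun_comp (g := A) (f := fun w => T (Ψ w)) (by rw [hΨ0, hT0]; exact hA) hTΨ
  have tΨ : Tendsto Ψ (𝓝 0) (𝓝 0) := by simpa [hΨ0] using hΨ.continuousAt.tendsto
  have tT : Tendsto (fun w => T (Ψ w)) (𝓝 0) (𝓝 0) := by
    simpa [hΨ0, hT0] using hTΨ.continuousAt.tendsto
  have tφ : Tendsto (fun w => A (T (Ψ w))) (𝓝 0) (𝓝 0) := by
    simpa [hΨ0, hT0, hA0] using hφ.continuousAt.tendsto
  have hval : ∀ᶠ w in 𝓝 (0 : ℂ × ℂ), ρ (A (T (Ψ w))) =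
      (Ψ w).1 * ((Ψ w).1 ^ 3 * c (Ψ w).1 + (Ψ w).2 ^ 2 * e (Ψ w)) := by
    filter_upwards [tT.eventually e2, tΨ.eventually e3] with w h2 h3
    rw [← h3]
    exact h2
  have hbase : ∀ᶠ w in 𝓝 (0 : ℂ × ℂ), AnalyticAt ℂ (fun w => A (T (Ψ w))) w ∧ D (Ψ w) = w ∧
      A (T (Ψ w)) ∈ U :=
    hφ.eventually_analyticAt.and (hΨe.and (tφ.eventually (hU.mem_nhds h0U)))
  have fin : ∀ N : ℂ × ℂ → ℂ, (∀ᶠ w in 𝓝 (0 : ℂ × ℂ), ρ (A (T (Ψ w))) = N w) →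
      ∃ V : Set (ℂ × ℂ), IsOpen V ∧ (0 : ℂ × ℂ) ∈ V ∧ AnalyticOnNhd ℂ (fun w => A (T (Ψ w))) V ∧
        A (T (Ψ 0)) = 0 ∧ Set.InjOn (fun w => A (T (Ψ w))) V ∧
        Set.MapsTo (fun w => A (T (Ψ w))) V U ∧ ∀ p ∈ V, ρ (A (T (Ψ p))) = N p := by
    intro N hN
    obtain ⟨V, hV, hVo, hV0⟩ := eventually_nhds_iff.1 (hbase.and hN)
    refine ⟨V, hVo, hV0, fun w hw => (hV w hw).1.1, by rw [hΨ0, hT0, hA0], ?_,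
      fun w hw => (hV w hw).1.2.2, fun w hw => (hV w hw).2⟩
    intro w hw w' hw' h
    have h1 := hTinj (hAinj h)
    rw [← (hV w hw).1.2.1, ← (hV w' hw').1.2.1, h1]
  rcases e4 with e4 | ⟨k, hk, e4⟩
  · obtain ⟨V, v1, v2, v3, v4, v5, v6, v7⟩ := fin (fun p => p.2 ^ 2 * p.1) (by
      filter_upwards [hval, tΨ.eventually e4, hΨe] with w h1 h2 h3
      have a1 : (Ψ w).1 * α (Ψ w).1 = w.1 := congrArg Prod.fst h3
      have a2 : (Ψ w).2 * η (Ψ w) = w.2 := congrArg Prod.snd h3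
      rw [h1, h2, a1, a2])
    exact ⟨V, _, v1, v2, v3, v4, v5, v6, Or.inl v7⟩
  · obtain ⟨V, v1, v2, v3, v4, v5, v6, v7⟩ := fin (fun p => p.2 ^ 2 * p.1 + p.1 ^ (k - 1)) (by
      filter_upwards [hval, tΨ.eventually e4, hΨe] with w h1 h2 h3
      have a1 : (Ψ w).1 * α (Ψ w).1 = w.1 := congrArg Prod.fst h3
      have a2 : (Ψ w).2 * η (Ψ w) = w.2 := congrArg Prod.snd h3
      rw [h1, h2, a1, a2])
    exact ⟨V, _, v1, v2, v3, v4, v5, v6, Or.inr ⟨k, hk, v7⟩⟩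
end

section
/- Let ρ be holomorphic near 0 in ℂ² with ρᵢⱼ = 0 for all (i,j) with i+j ≤ 2, and additionally ρ₃₀ = ρ₂₁ = ρ₁₂ = 0, ρ₀₃ ≠ 0, ρ₄₀ ≠ 0. Then there exists a holomorphic coordinate chart (u,v) centered at the origin with ρ(u,v) = v³ + u⁴ (E₆ normal form). -/
open Filter Topology

theorem hadamard {f : ℂ × ℂ → ℂ} (hf : AnalyticAt ℂ f 0) :
    ∃ a b : ℂ × ℂ → ℂ, AnalyticAt ℂ a 0 ∧ AnalyticAt ℂ b 0 ∧
      ∀ᶠ p in 𝓝 (0 : ℂ × ℂ), f p = f 0 + p.1 * a p + p.2 * b p := by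
  obtain ⟨P, r, hP⟩ := hf
  have hr : 0 < P.shift.radius := by
    rw [FormalMultilinearSeries.radius_shift]; exact hP.r_pos.trans_le hP.r_le
  have hG := P.shift.hasFPowerSeriesOnBall hr
  have hGa : AnalyticAt ℂ P.shift.sum 0 := hG.analyticAt
  refine ⟨fun p => P.shift.sum p (1, 0), fun p => P.shift.sum p (0, 1),
    ?_, ?_, ?_⟩
  · exact ((ContinuousLinearMap.apply ℂ ℂ ((1 : ℂ), (0 : ℂ))).analyticAt _).comp hGa
  · exact ((ContinuousLinearMap.apply ℂ ℂ ((0 : ℂ), (1 : ℂ))).analyticAt _).comp hGa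
  · have h2 := hG.unshift (z := f 0)
    have hball : ∀ᶠ p in 𝓝 (0 : ℂ × ℂ), p ∈ Metric.eball (0 : ℂ × ℂ) (min r P.shift.radius) :=
      Metric.eball_mem_nhds _ (lt_min hP.r_pos hr)
    filter_upwards [hball] with p hp
    have hp1 : p ∈ Metric.eball (0 : ℂ × ℂ) r := Metric.eball_subset_eball (min_le_left _ _) hp
    have hp2 : p ∈ Metric.eball (0 : ℂ × ℂ) P.shift.radius :=
      Metric.eball_subset_eball (min_le_right _ _) hp
    have e1 := hP.hasSum hp1
    have e2 := h2.hasSum hp2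
    have heq : P.shift.unshift (f 0) = P := by
      ext n v
      cases n with
      | zero =>
        simp [FormalMultilinearSeries.unshift]
        rw [← hP.coeff_zero v]
      | succ n =>
        simp [FormalMultilinearSeries.unshift, FormalMultilinearSeries.shift]
    rw [heq] at e2
    have e3 := e1.unique e2
    simp only [zero_add, sub_zero] at e3
    rw [e3]
    have : p = p.1 • ((1 : ℂ), (0 : ℂ)) + p.2 • ((0 : ℂ), (1 : ℂ)) := by ext <;> simp
    conv_lhs => rw [show P.shift.sum p p = P.shift.sum p (p.1 • ((1 : ℂ), (0 : ℂ)) + p.2 • ((0 : ℂ), (1 : ℂ))) from by rw [← this]]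
    rw [map_add, map_smul, map_smul]
    simp [add_assoc]

theorem inner_analytic {f : ℂ × ℂ → ℂ} (j : ℕ) {p : ℂ × ℂ} (hf : AnalyticAt ℂ f p) :
    AnalyticAt ℂ (fun q : ℂ × ℂ => iteratedDeriv j (fun y => f (q.1, y)) q.2) p := by
  induction j with
  | zero => simpa using hf
  | succ j ih =>
    have h1 : AnalyticAt ℂ (fun q => fderiv ℂ (fun q : ℂ × ℂ => iteratedDeriv j (fun y => f (q.1, y)) q.2) q (0, 1)) p :=
      ((ContinuousLinearMap.apply ℂ ℂ ((0 : ℂ), (1 : ℂ))).analyticAt _).comp ih.fderiv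
    refine h1.congr ?_
    filter_upwards [ih.eventually_analyticAt] with q hq
    rw [iteratedDeriv_succ]
    have h2 : HasDerivAt (fun y : ℂ => (q.1, y)) ((0 : ℂ), (1 : ℂ)) q.2 :=
      (hasDerivAt_const _ _).prodMk (hasDerivAt_id _)
    have h3 := (hq.differentiableAt.hasFDerivAt (x := (q.1, q.2))).comp_hasDerivAt q.2 h2
    exact h3.deriv.symm

theorem inner_analytic0 {f : ℂ × ℂ → ℂ} (j : ℕ) (hf : AnalyticAt ℂ f 0) :
    AnalyticAt ℂ (fun x : ℂ => iteratedDeriv j (fun y => f (x, y)) 0) 0 := by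
  have h : AnalyticAt ℂ (fun x : ℂ => (x, (0 : ℂ))) 0 := by fun_prop
  exact (inner_analytic (p := (0, 0)) j hf).comp_of_eq h rfl

theorem ev_slice {P : ℂ × ℂ → Prop} (h : ∀ᶠ p in 𝓝 (0 : ℂ × ℂ), P p) :
    ∀ᶠ x in 𝓝 (0 : ℂ), ∀ᶠ y in 𝓝 (0 : ℂ), P (x, y) := by
  rw [show (0 : ℂ × ℂ) = (0, 0) from rfl, nhds_prod_eq] at h
  exact h.curry

theorem pd_congr {f g : ℂ × ℂ → ℂ} (i j : ℕ) (h : ∀ᶠ p in 𝓝 (0 : ℂ × ℂ), f p = g p) :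
    pd i j f = pd i j g := by
  unfold pd
  apply Filter.EventuallyEq.iteratedDeriv_eq
  filter_upwards [ev_slice h] with x hx
  exact Filter.EventuallyEq.iteratedDeriv_eq _ hx

theorem slice_analytic {f : ℂ × ℂ → ℂ} (hf : AnalyticAt ℂ f 0) :
    ∀ᶠ x in 𝓝 (0 : ℂ), AnalyticAt ℂ (fun y => f (x, y)) 0 := by
  filter_upwards [ev_slice hf.eventually_analyticAt] with x hx
  have h : AnalyticAt ℂ (fun y : ℂ => (x, y)) 0 := by fun_prop
  exact hx.self_of_nhds.comp_of_eq h rfl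

theorem pd_add {f g : ℂ × ℂ → ℂ} (i j : ℕ) (hf : AnalyticAt ℂ f 0) (hg : AnalyticAt ℂ g 0) :
    pd i j (fun p => f p + g p) = pd i j f + pd i j g := by
  unfold pd
  rw [← iteratedDeriv_add (inner_analytic0 j hf).contDiffAt (inner_analytic0 j hg).contDiffAt]
  apply Filter.EventuallyEq.iteratedDeriv_eq
  filter_upwards [slice_analytic hf, slice_analytic hg] with x hx hy
  exact iteratedDeriv_add hx.contDiffAt hy.contDiffAt

theorem iter_id_mul (n : ℕ) {h : ℂ → ℂ} (hh : AnalyticAt ℂ h 0) :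
    iteratedDeriv n (fun z => z * h z) 0 = n * iteratedDeriv (n - 1) h 0 := by
  have := iteratedDeriv_mul (n := n) (f := fun z : ℂ => z) (g := h) (x := 0)
    (by fun_prop) hh.contDiffAt
  have e : (fun z => z * h z) = (fun z : ℂ => z) * h := rfl
  rw [e, this]
  have e2 : ∀ i, iteratedDeriv i (fun z : ℂ => z) 0 = if i = 1 then 1 else 0 := by
    intro i
    have := iteratedDeriv_id (𝕜 := ℂ) (n := i) (x := 0)
    rw [show (fun z : ℂ => z) = id from rfl, this]
    by_cases h0 : i = 0 <;> simp [h0]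
  simp only [e2]
  cases n with
  | zero => simp
  | succ n => simp

theorem pd_x_mul {f : ℂ × ℂ → ℂ} (i j : ℕ) (hf : AnalyticAt ℂ f 0) :
    pd i j (fun p => p.1 * f p) = i * pd (i - 1) j f := by
  unfold pd
  rw [← iter_id_mul i (inner_analytic0 j hf)]
  congr 1
  ext x
  exact iteratedDeriv_const_mul_field x _

theorem pd_y_mul {f : ℂ × ℂ → ℂ} (i j : ℕ) (hf : AnalyticAt ℂ f 0) :
    pd i j (fun p => p.2 * f p) = j * pd i (j - 1) f := by
  unfold pd
  rw [← iteratedDeriv_const_mul_field]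
  apply Filter.EventuallyEq.iteratedDeriv_eq
  filter_upwards [slice_analytic hf] with x hx
  exact iter_id_mul j hx

theorem pd_const (i j : ℕ) (c : ℂ) : pd i j (fun _ => c) = if i = 0 ∧ j = 0 then c else 0 := by
  unfold pd
  simp only [iteratedDeriv_const]
  split_ifs <;> simp_all
theorem pd_zero (f : ℂ × ℂ → ℂ) : pd 0 0 f = f 0 := by
  simp [pd]; rfl

@[fun_prop]
theorem an_fst (p : ℂ × ℂ) : AnalyticAt ℂ (fun q : ℂ × ℂ => q.1) p := analyticAt_fst

@[fun_prop]
theorem an_snd (p : ℂ × ℂ) : AnalyticAt ℂ (fun q : ℂ × ℂ => q.2) p := analyticAt_snd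

theorem pd_form {f A B C D : ℂ × ℂ → ℂ} {c0 c10 c01 c20 c11 c02 c30 c21 c12 : ℂ}
    (hA : AnalyticAt ℂ A 0) (hB : AnalyticAt ℂ B 0)
    (hC : AnalyticAt ℂ C 0) (hD : AnalyticAt ℂ D 0)
    (hfe : ∀ᶠ p in 𝓝 (0 : ℂ × ℂ), f p = c0 + p.1 * c10 + p.2 * c01 + p.1 * (p.1 * c20)
      + p.1 * (p.2 * c11) + p.2 * (p.2 * c02) + p.1 * (p.1 * (p.1 * c30))
      + p.1 * (p.1 * (p.2 * c21)) + p.1 * (p.2 * (p.2 * c12))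
      + p.1 * (p.1 * (p.1 * (p.1 * A p))) + p.1 * (p.1 * (p.1 * (p.2 * B p)))
      + p.1 * (p.1 * (p.2 * (p.2 * C p))) + p.2 * (p.2 * (p.2 * D p))) (i j : ℕ) :
    pd i j f = pd i j (fun _ => c0) + i * pd (i-1) j (fun _ => c10)
      + j * pd i (j-1) (fun _ => c01)
      + i * ((i-1 : ℕ) * pd (i-1-1) j (fun _ => c20))
      + i * (j * pd (i-1) (j-1) (fun _ => c11))
      + j * ((j-1 : ℕ) * pd i (j-1-1) (fun _ => c02))
      + i * ((i-1 : ℕ) * ((i-1-1 : ℕ) * pd (i-1-1-1) j (fun _ => c30)))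
      + i * ((i-1 : ℕ) * (j * pd (i-1-1) (j-1) (fun _ => c21)))
      + i * (j * ((j-1 : ℕ) * pd (i-1) (j-1-1) (fun _ => c12)))
      + i * ((i-1 : ℕ) * ((i-1-1 : ℕ) * ((i-1-1-1 : ℕ) * pd (i-1-1-1-1) j A)))
      + i * ((i-1 : ℕ) * ((i-1-1 : ℕ) * (j * pd (i-1-1-1) (j-1) B)))
      + i * ((i-1 : ℕ) * (j * ((j-1 : ℕ) * pd (i-1-1) (j-1-1) C)))
      + j * ((j-1 : ℕ) * ((j-1-1 : ℕ) * pd i (j-1-1-1) D)) := by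
  rw [pd_congr i j hfe]
  simp (disch := fun_prop) only [pd_add, pd_x_mul, pd_y_mul]

theorem decomposition {f : ℂ × ℂ → ℂ} (hf : AnalyticAt ℂ f 0)
    (hlow : ∀ i j : ℕ, i + j ≤ 2 → pd i j f = 0)
    (h30 : pd 3 0 f = 0) (h21 : pd 2 1 f = 0) (h12 : pd 1 2 f = 0)
    (h03 : pd 0 3 f ≠ 0) (h40 : pd 4 0 f ≠ 0) :
    ∃ A B C D : ℂ × ℂ → ℂ, AnalyticAt ℂ A 0 ∧ AnalyticAt ℂ B 0 ∧
      AnalyticAt ℂ C 0 ∧ AnalyticAt ℂ D 0 ∧ A 0 ≠ 0 ∧ D 0 ≠ 0 ∧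
      ∀ᶠ p in 𝓝 (0 : ℂ × ℂ), f p = p.1 ^ 4 * A p + p.1 ^ 3 * p.2 * B p
        + p.1 ^ 2 * p.2 ^ 2 * C p + p.2 ^ 3 * D p := by
  obtain ⟨a, b, ha, hb, e⟩ := hadamard hf
  obtain ⟨a1, a2, ha1, ha2, ea⟩ := hadamard ha
  obtain ⟨b1, b2, hb1, hb2, eb⟩ := hadamard hb
  obtain ⟨r1, r2, hr1, hr2, er⟩ := hadamard ha1
  obtain ⟨s1, s2, hs1, hs2, es⟩ := hadamard (ha2.fun_add hb1)
  obtain ⟨t1, t2, ht1, ht2, et⟩ := hadamard hb2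
  obtain ⟨u1, u2, hu1, hu2, eu⟩ := hadamard hr1
  obtain ⟨v1, v2, hv1, hv2, ev⟩ := hadamard (hr2.fun_add hs1)
  obtain ⟨w1, w2, hw1, hw2, ew⟩ := hadamard (hs2.fun_add ht1)
  have hA := hu1
  have hB := hu2.fun_add hv1
  have hC := hv2.fun_add hw1
  have hD : AnalyticAt ℂ (fun p => t2 p + p.1 * w2 p) 0 := by fun_prop
  have key : ∀ᶠ p in 𝓝 (0 : ℂ × ℂ), f p = f 0 + p.1 * a 0 + p.2 * b 0 + p.1 * (p.1 * a1 0)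
      + p.1 * (p.2 * (a2 0 + b1 0)) + p.2 * (p.2 * b2 0) + p.1 * (p.1 * (p.1 * r1 0))
      + p.1 * (p.1 * (p.2 * (r2 0 + s1 0))) + p.1 * (p.2 * (p.2 * (s2 0 + t1 0)))
      + p.1 * (p.1 * (p.1 * (p.1 * u1 p))) + p.1 * (p.1 * (p.1 * (p.2 * (u2 p + v1 p))))
      + p.1 * (p.1 * (p.2 * (p.2 * (v2 p + w1 p))))
      + p.2 * (p.2 * (p.2 * (t2 p + p.1 * w2 p))) := by
    filter_upwards [e, ea, eb, er, es, et, eu, ev, ew] with p e ea eb er es et eu ev ew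
    linear_combination e + p.1 * ea + p.2 * eb + p.1 ^ 2 * er + p.1 * p.2 * es + p.2 ^ 2 * et
      + p.1 ^ 3 * eu + p.1 ^ 2 * p.2 * ev + p.1 * p.2 ^ 2 * ew
  have F := pd_form hA hB hC hD key
  have k00 := hlow 0 0 (by norm_num)
  have k10 := hlow 1 0 (by norm_num)
  have k01 := hlow 0 1 (by norm_num)
  have k20 := hlow 2 0 (by norm_num)
  have k11 := hlow 1 1 (by norm_num)
  have k02 := hlow 0 2 (by norm_num)
  rw [F] at k00 k10 k01 k20 k11 k02 h30 h21 h12 h03 h40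
  simp [pd_const, pd_zero] at k00 k10 k01 k20 k11 k02 h30 h21 h12 h03 h40
  refine ⟨_, _, _, _, hA, hB, hC, hD, h40, by simpa using h03, ?_⟩
  filter_upwards [key] with p hp
  rw [hp, k00, k10, k01, k20, k11, k02, h30, h21, h12]
  ring

theorem inv_fun {E : Type*} [NormedAddCommGroup E] [NormedSpace ℂ E] [FiniteDimensional ℂ E]
    {f : E → E} {a : E} (hf : AnalyticAt ℂ f a)
    (hinj : ∀ v : E, fderiv ℂ f a v = 0 → v = 0) :
    ∃ g : E → E, AnalyticAt ℂ g (f a) ∧ g (f a) = a ∧ ∀ᶠ q in 𝓝 (f a), f (g q) = q := by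
  have : CompleteSpace E := FiniteDimensional.complete ℂ E
  have hi : Function.Injective (fderiv ℂ f a : E →ₗ[ℂ] E) := by
    rw [injective_iff_map_eq_zero]
    exact hinj
  let e : E ≃L[ℂ] E := (LinearEquiv.ofInjectiveEndo _ hi).toContinuousLinearEquiv
  have he : (e : E →L[ℂ] E) = fderiv ℂ f a := by
    ext v; rfl
  have hd : HasFDerivAt f (e : E →L[ℂ] E) a := by
    rw [he]; exact hf.differentiableAt.hasFDerivAt
  have hc : ContDiffAt ℂ ⊤ f a := hf.contDiffAt
  have hs : HasStrictFDerivAt f (e : E →L[ℂ] E) a := hc.hasStrictFDerivAt' hd (by simp)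
  refine ⟨hc.localInverse hd (by simp), ?_, hc.localInverse_apply_image hd (by simp), ?_⟩
  · exact (hc.to_localInverse hd (by simp)).analyticAt
  · exact hs.eventually_right_inverse

theorem line_deriv {E : Type*} [NormedAddCommGroup E] [NormedSpace ℂ E]
    {f : E → E} {a : E} (hf : AnalyticAt ℂ f a) (v : E) (hv : fderiv ℂ f a v = 0) :
    HasDerivAt (fun t : ℂ => f (a + t • v)) 0 0 := by
  have h2 : HasDerivAt (fun t : ℂ => a + t • v) v 0 := by
    simpa using ((hasDerivAt_id (0 : ℂ)).smul_const v).const_add a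
  have h3 : HasFDerivAt f (fderiv ℂ f a) (a + (0 : ℂ) • v) := by
    simpa using hf.differentiableAt.hasFDerivAt
  have := h3.comp_hasDerivAt (0 : ℂ) h2
  rwa [hv] at this

/-- The six-variable map used to solve for the coefficients of the coordinate change. -/
def bigMap (p : ℂ × ℂ × ℂ × ℂ × ℂ × ℂ) : ℂ × ℂ × ℂ × ℂ × ℂ × ℂ :=
  (p.1, p.2.1,
    p.2.2.1 ^ 4 + p.2.2.2.2.2 ^ 3 * p.1 ^ 2,
    4 * p.2.2.1 ^ 3 * p.2.2.2.1 + 3 * p.2.2.2.2.1 * p.2.2.2.2.2 ^ 2 * p.1,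
    6 * p.2.2.1 ^ 2 * p.2.2.2.1 ^ 2 + 3 * p.2.2.2.2.1 ^ 2 * p.2.2.2.2.2,
    p.2.2.2.2.1 ^ 3 + p.2.2.2.1 ^ 4 * p.2.1 + 4 * p.2.2.1 * p.2.2.2.1 ^ 3 * p.1)

theorem bigMap_analytic (p) : AnalyticAt ℂ bigMap p := by
  have : ContDiff ℂ ⊤ bigMap := by unfold bigMap; fun_prop
  exact this.contDiffAt.analyticAt

theorem bigMap_inj (α β γ δ : ℂ) (hα : α ≠ 0) (hγ : γ ≠ 0) (v : ℂ × ℂ × ℂ × ℂ × ℂ × ℂ)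
    (hv : fderiv ℂ bigMap (0, 0, α, β, γ, δ) v = 0) : v = 0 := by
  have h := line_deriv (bigMap_analytic _) v hv
  obtain ⟨v1, v2, v3, v4, v5, v6⟩ := v
  simp only [bigMap, Prod.smul_mk, Prod.mk_add_mk, smul_eq_mul, zero_add] at h
  have d (c w : ℂ) : HasDerivAt (fun t : ℂ => c + t * w) w 0 := by
    simpa using ((hasDerivAt_id (0 : ℂ)).mul_const w).const_add c
  have d0 (w : ℂ) : HasDerivAt (fun t : ℂ => t * w) w 0 := by
    simpa using ((hasDerivAt_id (0 : ℂ)).mul_const w)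
  have q1 := h.fst
  have q2 := h.snd.fst
  have q3 := h.snd.snd.fst
  have q4 := h.snd.snd.snd.fst
  have q5 := h.snd.snd.snd.snd.fst
  have q6 := h.snd.snd.snd.snd.snd
  simp only [Prod.fst_zero, Prod.snd_zero] at q1 q2 q3 q4 q5 q6
  have e1 : v1 = 0 := (d0 v1).unique q1
  have e2 : v2 = 0 := (d0 v2).unique q2
  subst e1 e2
  simp only [mul_zero, add_zero, ne_eq, OfNat.ofNat_ne_zero, not_false_eq_true, zero_pow] at q3 q4 q6
  have e3 := ((d α v3).fun_pow 4).unique q3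
  have e5 := ((d γ v5).fun_pow 3).unique q6
  have e3 : v3 = 0 := by simpa [hα] using e3
  have e5 : v5 = 0 := by simpa [hγ] using e5
  subst e3 e5
  simp only [mul_zero, add_zero] at q4 q5
  have e4 := ((d β v4).const_mul (4 * α ^ 3)).unique q4
  have e4 : v4 = 0 := by simpa [hα] using e4
  subst e4
  simp only [mul_zero, add_zero] at q5
  have e6 := (((d δ v6).const_mul (3 * γ ^ 2)).const_add (6 * α ^ 2 * β ^ 2)).unique q5
  have e6 : v6 = 0 := by simpa [hγ] using e6
  subst e6
  rfl

theorem solve_system {A B C D : ℂ × ℂ → ℂ} (hA : AnalyticAt ℂ A 0) (hB : AnalyticAt ℂ B 0)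
    (hC : AnalyticAt ℂ C 0) (hD : AnalyticAt ℂ D 0) (hA0 : A 0 ≠ 0) (hD0 : D 0 ≠ 0) :
    ∃ α β γ δ : ℂ × ℂ → ℂ, AnalyticAt ℂ α 0 ∧ AnalyticAt ℂ β 0 ∧ AnalyticAt ℂ γ 0 ∧
      AnalyticAt ℂ δ 0 ∧ α 0 ≠ 0 ∧ γ 0 ≠ 0 ∧ ∀ᶠ p in 𝓝 (0 : ℂ × ℂ),
        α p ^ 4 + δ p ^ 3 * p.1 ^ 2 = A p ∧
        4 * α p ^ 3 * β p + 3 * γ p * δ p ^ 2 * p.1 = B p ∧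
        6 * α p ^ 2 * β p ^ 2 + 3 * γ p ^ 2 * δ p = C p ∧
        γ p ^ 3 + β p ^ 4 * p.2 + 4 * α p * β p ^ 3 * p.1 = D p := by
  obtain ⟨a, ha⟩ := IsAlgClosed.exists_pow_nat_eq (A 0) (n := 4) (by norm_num)
  obtain ⟨c, hc⟩ := IsAlgClosed.exists_pow_nat_eq (D 0) (n := 3) (by norm_num)
  have ha0 : a ≠ 0 := by rintro rfl; simp at ha; exact hA0 ha.symm
  have hc0 : c ≠ 0 := by rintro rfl; simp at hc; exact hD0 hc.symm
  obtain ⟨b, hb⟩ : ∃ b, 4 * a ^ 3 * b = B 0 := ⟨B 0 / (4 * a ^ 3), by field_simp⟩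
  obtain ⟨d, hd⟩ : ∃ d, 6 * a ^ 2 * b ^ 2 + 3 * c ^ 2 * d = C 0 :=
    ⟨(C 0 - 6 * a ^ 2 * b ^ 2) / (3 * c ^ 2), by field_simp; ring⟩
  obtain ⟨g, hg, hg0, hge⟩ := inv_fun (bigMap_analytic (0, 0, a, b, c, d))
    (bigMap_inj a b c d ha0 hc0)
  let Q : ℂ × ℂ → ℂ × ℂ × ℂ × ℂ × ℂ × ℂ := fun p => (p.1, p.2, A p, B p, C p, D p)
  have hQ0 : Q 0 = bigMap (0, 0, a, b, c, d) := by
    simp [Q, bigMap, ha, hb, hc, hd]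
  have hQ : AnalyticAt ℂ Q 0 :=
    (an_fst 0).prod ((an_snd 0).prod (hA.prod (hB.prod (hC.prod hD))))
  have hG : AnalyticAt ℂ (fun p => g (Q p)) 0 := by
    rw [← hQ0] at hg
    exact hg.comp hQ
  have hG0 : g (Q 0) = (0, 0, a, b, c, d) := by rw [hQ0, hg0]
  have s {F : Type} [NormedAddCommGroup F] [NormedSpace ℂ F] {k : ℂ × ℂ → ℂ × F}
      (hk : AnalyticAt ℂ k 0) : AnalyticAt ℂ (fun p => (k p).2) 0 :=
    analyticAt_snd.comp hk
  have f {F : Type} [NormedAddCommGroup F] [NormedSpace ℂ F] {k : ℂ × ℂ → ℂ × F}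
      (hk : AnalyticAt ℂ k 0) : AnalyticAt ℂ (fun p => (k p).1) 0 :=
    analyticAt_fst.comp hk
  refine ⟨_, _, _, _, f (s (s hG)), f (s (s (s hG))), f (s (s (s (s hG)))), s (s (s (s (s hG)))),
    by simpa [hG0] using ha0, by simpa [hG0] using hc0, ?_⟩
  rw [← hQ0] at hge
  filter_upwards [hQ.continuousAt.eventually hge] with p hp
  simp only [bigMap, Q, Prod.mk.injEq] at hp
  obtain ⟨p1, p2, p3, p4, p5, p6⟩ := hp
  rw [p1] at p3 p4 p6
  rw [p2] at p6
  exact ⟨p3, p4, p5, p6⟩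

theorem mul_line {h : ℂ → ℂ} (hh : ContinuousAt h 0) :
    HasDerivAt (fun t : ℂ => t * h t) (h 0) 0 := by
  rw [hasDerivAt_iff_tendsto_slope]
  refine (hh.tendsto.mono_left nhdsWithin_le_nhds).congr' ?_
  filter_upwards [self_mem_nhdsWithin] with t ht
  have : t ≠ 0 := ht
  simp [slope_def_field, this]

theorem coord_inj {α β γ δ : ℂ × ℂ → ℂ} (hα : AnalyticAt ℂ α 0) (hβ : AnalyticAt ℂ β 0)
    (hγ : AnalyticAt ℂ γ 0) (hδ : AnalyticAt ℂ δ 0) (hα0 : α 0 ≠ 0) (hγ0 : γ 0 ≠ 0)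
    (hΦ : AnalyticAt ℂ (fun p : ℂ × ℂ =>
      (p.1 * α p + p.2 * β p, p.2 * γ p + p.1 ^ 2 * δ p)) 0) (v : ℂ × ℂ)
    (hv : fderiv ℂ (fun p : ℂ × ℂ =>
      (p.1 * α p + p.2 * β p, p.2 * γ p + p.1 ^ 2 * δ p)) 0 v = 0) : v = 0 := by
  have h := line_deriv hΦ v hv
  have hl : ContinuousAt (fun t : ℂ => (0 : ℂ × ℂ) + t • v) 0 := by fun_prop
  have c {k : ℂ × ℂ → ℂ} (hk : AnalyticAt ℂ k 0) :
      ContinuousAt (fun t : ℂ => k (0 + t • v)) 0 :=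
    hk.continuousAt.comp_of_eq hl (by simp)
  have cα := c hα
  have cβ := c hβ
  have cγ := c hγ
  have cδ := c hδ
  have h1 := mul_line (h := fun t => v.1 * α (0 + t • v) + v.2 * β (0 + t • v))
    ((continuousAt_const.mul cα).add (continuousAt_const.mul cβ))
  have h2 := mul_line (h := fun t => v.2 * γ (0 + t • v) + t * v.1 ^ 2 * δ (0 + t • v))
    ((continuousAt_const.mul cγ).add ((continuousAt_id.mul continuousAt_const).mul cδ))
  have q1 : HasDerivAt (fun t : ℂ => t * (v.1 * α (0 + t • v) + v.2 * β (0 + t • v))) 0 0 := by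
    have q : HasDerivAt (fun t : ℂ => (0 + t • v).1 * α (0 + t • v)
      + (0 + t • v).2 * β (0 + t • v)) 0 0 := h.fst
    convert q using 2 with t
    simp only [zero_add, Prod.smul_fst, Prod.smul_snd, smul_eq_mul]
    ring
  have q2 : HasDerivAt (fun t : ℂ => t * (v.2 * γ (0 + t • v)
      + t * v.1 ^ 2 * δ (0 + t • v))) 0 0 := by
    have q : HasDerivAt (fun t : ℂ => (0 + t • v).2 * γ (0 + t • v)
      + (0 + t • v).1 ^ 2 * δ (0 + t • v)) 0 0 := h.snd
    convert q using 2 with t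
    simp only [zero_add, Prod.smul_fst, Prod.smul_snd, smul_eq_mul]
    ring
  have e1 := h1.unique q1
  have e2 := h2.unique q2
  have e2 : v.2 = 0 := by simpa [hγ0] using e2
  have e1 : v.1 = 0 := by simpa [hα0, e2] using e1
  exact Prod.ext e1 e2

theorem stmt_10 (U : Set (ℂ × ℂ)) (hU : IsOpen U) (h0U : (0 : ℂ × ℂ) ∈ U)
    (ρ : ℂ × ℂ → ℂ) (hρ : AnalyticOnNhd ℂ ρ U)
    (hlow : ∀ i j : ℕ, i + j ≤ 2 → pd i j ρ = 0)
    (h30 : pd 3 0 ρ = 0) (h21 : pd 2 1 ρ = 0) (h12 : pd 1 2 ρ = 0)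
    (h03 : pd 0 3 ρ ≠ 0) (h40 : pd 4 0 ρ ≠ 0) :
    ∃ (V : Set (ℂ × ℂ)) (φ : ℂ × ℂ → ℂ × ℂ),
      IsOpen V ∧ (0 : ℂ × ℂ) ∈ V ∧ AnalyticOnNhd ℂ φ V ∧ φ 0 = 0 ∧
      Set.InjOn φ V ∧ Set.MapsTo φ V U ∧
      ∀ p ∈ V, ρ (φ p) = p.2 ^ 3 + p.1 ^ 4 := by
  obtain ⟨A, B, C, D, hA, hB, hC, hD, hA0, hD0, hdec⟩ :=
    decomposition (hρ 0 h0U) hlow h30 h21 h12 h03 h40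
  obtain ⟨α, β, γ, δ, hα, hβ, hγ, hδ, hα0, hγ0, hsys⟩ := solve_system hA hB hC hD hA0 hD0
  have hΦ : AnalyticAt ℂ (fun p : ℂ × ℂ =>
      (p.1 * α p + p.2 * β p, p.2 * γ p + p.1 ^ 2 * δ p)) 0 :=
    AnalyticAt.prod (by fun_prop) (by fun_prop)
  obtain ⟨φ, hφ, hφ0, hφe⟩ := inv_fun hΦ (coord_inj hα hβ hγ hδ hα0 hγ0 hΦ)
  have hz : ((0 : ℂ × ℂ).1 * α 0 + (0 : ℂ × ℂ).2 * β 0,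
      (0 : ℂ × ℂ).2 * γ 0 + (0 : ℂ × ℂ).1 ^ 2 * δ 0) = (0 : ℂ × ℂ) := by simp
  simp only [hz] at hφ hφ0 hφe
  have hcont : Tendsto φ (𝓝 0) (𝓝 0) := by
    have := hφ.continuousAt.tendsto
    rwa [hφ0] at this
  have hev : ∀ᶠ q in 𝓝 (0 : ℂ × ℂ), AnalyticAt ℂ φ q ∧ φ q ∈ U ∧
      ((φ q).1 * α (φ q) + (φ q).2 * β (φ q),
        (φ q).2 * γ (φ q) + (φ q).1 ^ 2 * δ (φ q)) = q ∧ ρ (φ q) = q.2 ^ 3 + q.1 ^ 4 := by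
    filter_upwards [hφ.eventually_analyticAt, hcont.eventually (hU.mem_nhds h0U), hφe,
      hcont.eventually hdec, hcont.eventually hsys] with q h1 h2 h3 h4 h5
    refine ⟨h1, h2, h3, ?_⟩
    obtain ⟨s1, s2, s3, s4⟩ := h5
    have k1 := congrArg Prod.fst h3
    have k2 := congrArg Prod.snd h3
    simp only at k1 k2
    rw [h4, ← s1, ← s2, ← s3, ← s4, ← k1, ← k2]
    ring
  obtain ⟨V, hV, hVo, hV0⟩ := eventually_nhds_iff.mp hev
  refine ⟨V, φ, hVo, hV0, fun q hq => (hV q hq).1, hφ0, ?_, fun q hq => (hV q hq).2.1,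
    fun q hq => (hV q hq).2.2.2⟩
  intro q hq q' hq' heq
  have e1 := (hV q hq).2.2.1
  have e2 := (hV q' hq').2.2.1
  rw [← e1, ← e2, heq]
end
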